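/- Bound on the self-normalized importance weights: with the notation of the context, for every i = 1,…,N and every x ∈ ℝ^d, p^{(i)}(x) / (Z_mix · q^{(i)}(x)) ≤ (det Q_t / det Q)^{1/2} · ( (1/N)·Σ_{j=1}^N exp(−(1/2)·(y − H·z_j)^⊤·S^{-1}·(y − H·z_j)) )^{-1}. -/

import Mathlib

open Matrix MeasureTheory

/-- The Gaussian density `𝒩(μ, C)(x)` on `ℝ^d` with mean `μ` and (symmetric
positive definite) covariance matrix `C`. -/
noncomputable def gaussDensity {d : ℕ} (μ : Fin d → ℝ)
    (C : Matrix (Fin d) (Fin d) ℝ) (x : Fin d → ℝ) : ℝ :=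
  (2 * Real.pi) ^ (-(d : ℝ) / 2) * C.det ^ (-(1 : ℝ) / 2) *
    Real.exp (-(1 / 2) * ((x - μ) ⬝ᵥ C⁻¹.mulVec (x - μ)))

namespace Matrix

variable {n k : Type*} [Fintype n] [DecidableEq n] [Fintype k] [DecidableEq k]

open scoped MatrixOrder in
theorem PosSemidef.exists_eq_transpose_mul_self {A : Matrix n n ℝ} (hA : A.PosSemidef) :
    ∃ B : Matrix n n ℝ, A = Bᵀ * B := by
  obtain ⟨B, hB⟩ := CStarAlgebra.nonneg_iff_eq_star_mul_self.mp hA.nonneg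
  exact ⟨B, by simpa [star_eq_conjTranspose] using hB⟩

theorem PosSemidef.one_le_det_one_add {A : Matrix n n ℝ} (hA : A.PosSemidef) :
    1 ≤ (1 + A).det := by
  have hone : (1 : Matrix n n ℝ).PosSemidef := PosSemidef.one
  have hB := hone.1.add hA.1
  rw [hB.det_eq_prod_eigenvalues]
  have key : ∀ i, 1 ≤ hB.eigenvalues i := by
    intro i
    have h1 := hB.mulVec_eigenvectorBasis i
    have hv : (hB.eigenvectorBasis i).ofLp ≠ 0 := by
      have := hB.eigenvectorBasis.toBasis.ne_zero i
      simpa using this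
    have hpos := dotProduct_star_self_pos_iff.2 hv
    have h2 := hA.dotProduct_mulVec_nonneg (hB.eigenvectorBasis i).ofLp
    have h3 := congrArg (fun w => (hB.eigenvectorBasis i).ofLp ⬝ᵥ w) h1
    simp only [add_mulVec, one_mulVec, dotProduct_add, dotProduct_smul, smul_eq_mul] at h3
    simp only [star_trivial] at h2 hpos
    nlinarith
  have : ∏ i : n, (1 : ℝ) ≤ ∏ i, hB.eigenvalues i :=
    Finset.prod_le_prod (fun _ _ => zero_le_one) fun i _ => key i
  simpa using this

/-- The determinant is monotone for the Loewner order on positive definite matrices. -/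
theorem PosDef.det_le_det_add {A P : Matrix n n ℝ} (hA : A.PosDef) (hP : P.PosSemidef) :
    A.det ≤ (A + P).det := by
  obtain ⟨B, rfl⟩ := hA.posSemidef.exists_eq_transpose_mul_self
  have hd := hA.det_pos
  have hBu : IsUnit B.det := by
    rw [det_mul, det_transpose] at hd
    exact isUnit_iff_ne_zero.2 fun h => by simp [h] at hd
  have hM : ((B⁻¹)ᵀ * P * B⁻¹).PosSemidef := by
    simpa using hP.conjTranspose_mul_mul_same B⁻¹
  have h1 : Bᵀ * (B⁻¹)ᵀ = 1 := by
    rw [← transpose_mul, nonsing_inv_mul _ hBu, transpose_one]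
  have heq : Bᵀ * B + P = Bᵀ * (1 + (B⁻¹)ᵀ * P * B⁻¹) * B := by
    rw [Matrix.mul_add, Matrix.add_mul, Matrix.mul_one]
    congr 1
    calc P = (Bᵀ * (B⁻¹)ᵀ) * P * (B⁻¹ * B) := by
            rw [h1, nonsing_inv_mul _ hBu, Matrix.one_mul, Matrix.mul_one]
      _ = _ := by simp only [Matrix.mul_assoc]
  have hdet : (Bᵀ * B + P).det = (Bᵀ * B).det * (1 + (B⁻¹)ᵀ * P * B⁻¹).det := by
    rw [heq, det_mul, det_mul, det_mul]
    ring
  rw [hdet]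
  exact le_mul_of_one_le_right hd.le hM.one_le_det_one_add

theorem PosDef.inv_transpose {A : Matrix n n ℝ} (hA : A.PosDef) : (A⁻¹)ᵀ = A⁻¹ := by
  simpa using hA.inv.isHermitian.eq

theorem PosDef.two_mul_dotProduct_le {A : Matrix n n ℝ} (hA : A.PosDef) (u a : n → ℝ) :
    2 * (u ⬝ᵥ a) ≤ u ⬝ᵥ A⁻¹ *ᵥ u + a ⬝ᵥ A *ᵥ a := by
  have hAu : IsUnit A.det := isUnit_iff_ne_zero.2 hA.det_pos.ne'
  have h := hA.inv.posSemidef.dotProduct_mulVec_nonneg (u - A *ᵥ a)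
  have h2 : (A *ᵥ a) ⬝ᵥ A⁻¹ *ᵥ u = u ⬝ᵥ a := by
    rw [dotProduct_mulVec, ← mulVec_transpose, hA.inv_transpose, mulVec_mulVec,
      nonsing_inv_mul _ hAu, one_mulVec, dotProduct_comm]
  simp only [star_trivial, mulVec_sub, mulVec_mulVec, nonsing_inv_mul _ hAu, one_mulVec,
    sub_dotProduct, dotProduct_sub, h2] at h
  rw [dotProduct_comm (A *ᵥ a) a] at h
  linarith

/-- The noise-weighted norm of `A u - K w` in the covariance `A Q Aᵀ + K R Kᵀ` is at most the
joint noise-weighted norm of `(u, w)`. -/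
theorem dotProduct_inv_mulVec_sub_le {A Q : Matrix n n ℝ} {K : Matrix n k ℝ} {R : Matrix k k ℝ}
    (hQ : Q.PosDef) (hR : R.PosDef) (hC : IsUnit (A * Q * Aᵀ + K * R * Kᵀ).det)
    (u : n → ℝ) (w : k → ℝ) :
    (A *ᵥ u - K *ᵥ w) ⬝ᵥ (A * Q * Aᵀ + K * R * Kᵀ)⁻¹ *ᵥ (A *ᵥ u - K *ᵥ w) ≤
      w ⬝ᵥ R⁻¹ *ᵥ w + u ⬝ᵥ Q⁻¹ *ᵥ u := by
  set C := A * Q * Aᵀ + K * R * Kᵀ with hCdef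
  set v := A *ᵥ u - K *ᵥ w with hv
  set l := C⁻¹ *ᵥ v with hl
  have hCl : C *ᵥ l = v := by rw [hl, mulVec_mulVec, mul_nonsing_inv _ hC, one_mulVec]
  have h1 := hQ.two_mul_dotProduct_le u (Aᵀ *ᵥ l)
  have h2 := hR.two_mul_dotProduct_le (-w) (Kᵀ *ᵥ l)
  have e1 : u ⬝ᵥ Aᵀ *ᵥ l = (A *ᵥ u) ⬝ᵥ l := by
    rw [dotProduct_mulVec, vecMul_transpose]
  have e2 : w ⬝ᵥ Kᵀ *ᵥ l = (K *ᵥ w) ⬝ᵥ l := by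
    rw [dotProduct_mulVec, vecMul_transpose]
  have e3 : l ⬝ᵥ C *ᵥ l = (Aᵀ *ᵥ l) ⬝ᵥ Q *ᵥ (Aᵀ *ᵥ l) + (Kᵀ *ᵥ l) ⬝ᵥ R *ᵥ (Kᵀ *ᵥ l) := by
    rw [hCdef, add_mulVec, dotProduct_add, ← mulVec_mulVec, ← mulVec_mulVec, ← mulVec_mulVec,
      ← mulVec_mulVec, dotProduct_mulVec l A, dotProduct_mulVec l K, mulVec_transpose,
      mulVec_transpose]
  have e4 : v ⬝ᵥ l = (A *ᵥ u) ⬝ᵥ l - (K *ᵥ w) ⬝ᵥ l := by rw [hv, sub_dotProduct]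
  have e5 : l ⬝ᵥ C *ᵥ l = v ⬝ᵥ l := by rw [hCl, dotProduct_comm]
  simp only [neg_dotProduct, mulVec_neg, dotProduct_neg, neg_neg] at h2
  linarith

theorem posDef_mul_mul_transpose_add {n k : Type*} [Fintype n] [Fintype k]
    {Q : Matrix n n ℝ} {R : Matrix k k ℝ}
    (hQ : Q.PosSemidef) (hR : R.PosDef) (H : Matrix k n ℝ) : (H * Q * Hᵀ + R).PosDef := by
  simpa using PosDef.posSemidef_add (hQ.mul_mul_conjTranspose_same H) hR

theorem PosDef.inv_add_transpose_mul_inv_mul {Q : Matrix n n ℝ} {R : Matrix k k ℝ}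
    (hQ : Q.PosDef) (hR : R.PosDef) (H : Matrix k n ℝ) : (Q⁻¹ + Hᵀ * R⁻¹ * H).PosDef := by
  simpa using hQ.inv.add_posSemidef (hR.inv.posSemidef.conjTranspose_mul_mul_same H)

/-- The covariance produced by an arbitrary gain is nondegenerate. -/
theorem posDef_gain_covariance {n k : Type*} [Fintype n] [DecidableEq n] [Fintype k]
    {Q : Matrix n n ℝ} {R : Matrix k k ℝ}
    (hQ : Q.PosDef) (hR : R.PosDef) (H : Matrix k n ℝ) (K : Matrix n k ℝ) :
    ((1 - K * H) * Q * (1 - K * H)ᵀ + K * R * Kᵀ).PosDef := by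
  have h1 : ((1 - K * H) * Q * (1 - K * H)ᵀ).PosSemidef := by
    simpa only [conjTranspose_eq_transpose_of_trivial] using
      hQ.posSemidef.mul_mul_conjTranspose_same (1 - K * H)
  have h2 : (K * R * Kᵀ).PosSemidef := by
    simpa using hR.posSemidef.mul_mul_conjTranspose_same K
  refine .of_dotProduct_mulVec_pos (h1.add h2).1 fun v hv => ?_
  have a1 : star v ⬝ᵥ ((1 - K * H) * Q * (1 - K * H)ᵀ) *ᵥ v =
      star ((1 - K * H)ᵀ *ᵥ v) ⬝ᵥ Q *ᵥ ((1 - K * H)ᵀ *ᵥ v) := by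
    rw [star_trivial, star_trivial, ← mulVec_mulVec, ← mulVec_mulVec, dotProduct_mulVec v,
      ← mulVec_transpose]
  have a2 : star v ⬝ᵥ (K * R * Kᵀ) *ᵥ v = star (Kᵀ *ᵥ v) ⬝ᵥ R *ᵥ (Kᵀ *ᵥ v) := by
    rw [star_trivial, star_trivial, ← mulVec_mulVec, ← mulVec_mulVec, dotProduct_mulVec v,
      ← mulVec_transpose]
  rw [add_mulVec, dotProduct_add]
  by_cases hK : Kᵀ *ᵥ v = 0
  · have hA : (1 - K * H)ᵀ *ᵥ v = v := by
      rw [transpose_sub, transpose_one, transpose_mul, sub_mulVec, one_mulVec, ← mulVec_mulVec,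
        hK, mulVec_zero, sub_zero]
    rw [a1, hA]
    exact add_pos_of_pos_of_nonneg (hQ.dotProduct_mulVec_pos hv)
      (h2.dotProduct_mulVec_nonneg v)
  · rw [a2]
    exact add_pos_of_nonneg_of_pos (h1.dotProduct_mulVec_nonneg v)
      (hR.dotProduct_mulVec_pos hK)

/-- The determinant of the Kalman analysis covariance, in Joseph form, at the optimal gain. -/
theorem det_kalman_covariance {Q : Matrix n n ℝ} {R : Matrix k k ℝ}
    (hQ : Q.PosDef) (hR : R.PosDef) (H : Matrix k n ℝ) {K : Matrix n k ℝ} {S : Matrix k k ℝ}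
    (hS : S = H * Q * Hᵀ + R) (hK : K = Q * Hᵀ * S⁻¹) :
    ((1 - K * H) * Q * (1 - K * H)ᵀ + K * R * Kᵀ).det = Q.det * R.det / S.det := by
  have hSp : S.PosDef := hS ▸ posDef_mul_mul_transpose_add hQ.posSemidef hR H
  have hSu : IsUnit S.det := isUnit_iff_ne_zero.2 hSp.det_pos.ne'
  have hKS : K * S = Q * Hᵀ := by
    rw [hK, Matrix.mul_assoc, nonsing_inv_mul _ hSu, Matrix.mul_one]
  have hcov : (1 - K * H) * Q * (1 - K * H)ᵀ + K * R * Kᵀ = (1 - K * H) * Q := by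
    have hz : (K * S - Q * Hᵀ) * Kᵀ = 0 := by rw [hKS, sub_self, Matrix.zero_mul]
    rw [← sub_eq_zero, ← hz, hS]
    simp only [transpose_sub, transpose_one, transpose_mul, Matrix.mul_sub, Matrix.sub_mul,
      Matrix.mul_add, Matrix.add_mul, Matrix.mul_one, Matrix.one_mul, Matrix.mul_assoc]
    abel
  have hfac : (1 - H * K) * S = R := by
    rw [Matrix.sub_mul, Matrix.one_mul, Matrix.mul_assoc, hKS, hS, Matrix.mul_assoc]
    abel
  have hdet : (1 - H * K).det * S.det = R.det := by rw [← det_mul, hfac]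
  rw [hcov, det_mul, det_one_sub_mul_comm, eq_div_iff hSp.det_pos.ne', ← hdet]
  ring

theorem det_mul_det_inv_add {Q : Matrix n n ℝ} {R : Matrix k k ℝ}
    (hQ : Q.PosDef) (hR : R.PosDef) (H : Matrix k n ℝ) :
    (H * Q * Hᵀ + R).det = R.det * (Q.det * (Q⁻¹ + Hᵀ * R⁻¹ * H).det) := by
  have hQu : IsUnit Q.det := isUnit_iff_ne_zero.2 hQ.det_pos.ne'
  rw [add_comm, det_add_mul _ _ (isUnit_iff_ne_zero.2 hR.det_pos.ne'), ← det_mul, Matrix.mul_add,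
    mul_nonsing_inv _ hQu, ← Matrix.mul_assoc (Hᵀ * R⁻¹), det_one_add_mul_comm _ Q]

/-- Completing the square in the Gaussian posterior with linear observation. -/
theorem complete_square {Q : Matrix n n ℝ} {R : Matrix k k ℝ}
    (hQ : Q.PosDef) (hR : R.PosDef) (H : Matrix k n ℝ) (u : n → ℝ) (e : k → ℝ) :
    (e - H *ᵥ u) ⬝ᵥ R⁻¹ *ᵥ (e - H *ᵥ u) + u ⬝ᵥ Q⁻¹ *ᵥ u =
      e ⬝ᵥ (H * Q * Hᵀ + R)⁻¹ *ᵥ e +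
        (u - Q *ᵥ Hᵀ *ᵥ (H * Q * Hᵀ + R)⁻¹ *ᵥ e) ⬝ᵥ (Q⁻¹ + Hᵀ * R⁻¹ * H) *ᵥ
          (u - Q *ᵥ Hᵀ *ᵥ (H * Q * Hᵀ + R)⁻¹ *ᵥ e) := by
  have hSp := posDef_mul_mul_transpose_add hQ.posSemidef hR H
  have hP := hQ.inv_add_transpose_mul_inv_mul hR H
  have hPt : (Q⁻¹ + Hᵀ * R⁻¹ * H)ᵀ = Q⁻¹ + Hᵀ * R⁻¹ * H := by simpa using hP.isHermitian.eq
  have hQu : IsUnit Q.det := isUnit_iff_ne_zero.2 hQ.det_pos.ne'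
  have hRu : IsUnit R.det := isUnit_iff_ne_zero.2 hR.det_pos.ne'
  have hSu := isUnit_iff_ne_zero.2 hSp.det_pos.ne'
  set f := (H * Q * Hᵀ + R)⁻¹ *ᵥ e with hf
  have he : H *ᵥ Q *ᵥ Hᵀ *ᵥ f + R *ᵥ f = e := by
    simp only [mulVec_mulVec, ← Matrix.mul_assoc, ← add_mulVec]
    rw [hf, mulVec_mulVec, mul_nonsing_inv _ hSu, one_mulVec]
  set g := Q *ᵥ Hᵀ *ᵥ f with hg
  have hPg : (Q⁻¹ + Hᵀ * R⁻¹ * H) *ᵥ g = Hᵀ *ᵥ R⁻¹ *ᵥ e := by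
    rw [← he, mulVec_add, mulVec_mulVec f R⁻¹ R, nonsing_inv_mul _ hRu, one_mulVec, mulVec_add,
      add_mulVec, ← mulVec_mulVec, ← mulVec_mulVec]
    nth_rewrite 1 [hg]
    rw [mulVec_mulVec _ Q⁻¹ Q, nonsing_inv_mul _ hQu, one_mulVec, add_comm]
  have hgP : g ⬝ᵥ (Q⁻¹ + Hᵀ * R⁻¹ * H) *ᵥ u = u ⬝ᵥ Hᵀ *ᵥ R⁻¹ *ᵥ e := by
    rw [dotProduct_mulVec, ← mulVec_transpose, hPt, hPg, dotProduct_comm]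
  have hRs : ∀ a b : k → ℝ, a ⬝ᵥ R⁻¹ *ᵥ b = b ⬝ᵥ R⁻¹ *ᵥ a := fun a b => by
    rw [dotProduct_mulVec, ← mulVec_transpose, hR.inv_transpose, dotProduct_comm]
  have hHt : ∀ (a : n → ℝ) (b : k → ℝ), a ⬝ᵥ Hᵀ *ᵥ b = (H *ᵥ a) ⬝ᵥ b := fun a b => by
    rw [dotProduct_mulVec, vecMul_transpose]
  have hgg : g ⬝ᵥ Hᵀ *ᵥ R⁻¹ *ᵥ e = e ⬝ᵥ R⁻¹ *ᵥ e - e ⬝ᵥ f := by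
    have hHg : H *ᵥ g = e - R *ᵥ f := eq_sub_of_add_eq he
    rw [hHt, hHg, sub_dotProduct, hRs (R *ᵥ f) e, mulVec_mulVec, nonsing_inv_mul _ hRu, one_mulVec]
  simp only [mulVec_sub, sub_dotProduct, dotProduct_sub, hPg, hgP, hgg]
  rw [hRs (H *ᵥ u) e, hHt u, hRs (H *ᵥ u) e, add_mulVec, dotProduct_add, ← mulVec_mulVec,
    ← mulVec_mulVec, hHt u]
  ring

theorem integral_exp_neg_half_dotProduct_self {n : Type*} [Fintype n] :
    ∫ x : n → ℝ, Real.exp (-(1 / 2) * (x ⬝ᵥ x)) =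
      (2 * Real.pi) ^ ((Fintype.card n : ℝ) / 2) := by
  have h : ∀ x : n → ℝ, Real.exp (-(1 / 2) * (x ⬝ᵥ x)) =
      ∏ i, Real.exp (-(1 / 2) * x i ^ 2) := fun x => by
    rw [← Real.exp_sum, dotProduct, Finset.mul_sum]
    simp only [sq]
  simp_rw [h]
  rw [integral_fintype_prod_volume_eq_pow (fun t : ℝ => Real.exp (-(1 / 2) * t ^ 2)),
    integral_gaussian, Real.sqrt_eq_rpow, ← Real.rpow_mul_natCast (by positivity)]
  congr 1 <;> ring

/-- The Gaussian integral with precision matrix `P` and mean `a`. -/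
theorem PosDef.integral_exp_neg_half {P : Matrix n n ℝ} (hP : P.PosDef) (a : n → ℝ) :
    ∫ x : n → ℝ, Real.exp (-(1 / 2) * ((x - a) ⬝ᵥ P *ᵥ (x - a))) =
      (2 * Real.pi) ^ ((Fintype.card n : ℝ) / 2) * (√P.det)⁻¹ := by
  rw [integral_sub_right_eq_self (fun x : n → ℝ => Real.exp (-(1 / 2) * (x ⬝ᵥ P *ᵥ x)))]
  obtain ⟨B, rfl⟩ := hP.posSemidef.exists_eq_transpose_mul_self
  have hd := hP.det_pos
  rw [det_mul, det_transpose] at hd ⊢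
  have hB : B.det ≠ 0 := fun h => by simp [h] at hd
  have hq : ∀ x : n → ℝ, x ⬝ᵥ (Bᵀ * B) *ᵥ x = toLin' B x ⬝ᵥ toLin' B x := fun x => by
    rw [← mulVec_mulVec, dotProduct_mulVec, vecMul_transpose, toLin'_apply]
  simp_rw [hq]
  have hc : Continuous (toLin' B) := (toLin' B).continuous_of_finiteDimensional
  have hcd : Continuous fun x : n → ℝ => x ⬝ᵥ x := by
    simp only [dotProduct]
    fun_prop
  rw [← integral_map (f := fun x : n → ℝ => Real.exp (-(1 / 2) * (x ⬝ᵥ x))) hc.aemeasurable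
      (by fun_prop), Real.map_matrix_volume_pi_eq_smul_volume_pi hB, integral_smul_measure,
    integral_exp_neg_half_dotProduct_self, Real.sqrt_mul_self_eq_abs,
    ENNReal.toReal_ofReal (abs_nonneg _), abs_inv, smul_eq_mul, mul_comm]

end Matrix

theorem gaussDensity_eq {d : ℕ} (μ : Fin d → ℝ) {C : Matrix (Fin d) (Fin d) ℝ} (hC : C.PosDef)
    (x : Fin d → ℝ) :
    gaussDensity μ C x = (2 * Real.pi) ^ (-(d : ℝ) / 2) * (√C.det)⁻¹ *
      Real.exp (-(1 / 2) * ((x - μ) ⬝ᵥ C⁻¹ *ᵥ (x - μ))) := by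
  rw [gaussDensity, neg_div (2 : ℝ) 1, Real.rpow_neg hC.det_pos.le, ← Real.sqrt_eq_rpow]

/-- The evidence of a linear Gaussian observation with a Gaussian prior. -/
theorem integral_likelihood_mul_gaussDensity {d m : ℕ} {Q : Matrix (Fin d) (Fin d) ℝ}
    {R : Matrix (Fin m) (Fin m) ℝ} (hQ : Q.PosDef) (hR : R.PosDef)
    (H : Matrix (Fin m) (Fin d) ℝ) (y : Fin m → ℝ) (z : Fin d → ℝ) :
    ∫ x, Real.exp (-(1 / 2) * ((y - H *ᵥ x) ⬝ᵥ R⁻¹ *ᵥ (y - H *ᵥ x))) * gaussDensity z Q x =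
      √(R.det / (H * Q * Hᵀ + R).det) *
        Real.exp (-(1 / 2) * ((y - H *ᵥ z) ⬝ᵥ (H * Q * Hᵀ + R)⁻¹ *ᵥ (y - H *ᵥ z))) := by
  have hP := hQ.inv_add_transpose_mul_inv_mul hR H
  set e := y - H *ᵥ z with he
  set g := Q *ᵥ Hᵀ *ᵥ (H * Q * Hᵀ + R)⁻¹ *ᵥ e with hg
  have hint : ∀ x, Real.exp (-(1 / 2) * ((y - H *ᵥ x) ⬝ᵥ R⁻¹ *ᵥ (y - H *ᵥ x))) *
      gaussDensity z Q x =
      ((2 * Real.pi) ^ (-(d : ℝ) / 2) * (√Q.det)⁻¹ *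
        Real.exp (-(1 / 2) * (e ⬝ᵥ (H * Q * Hᵀ + R)⁻¹ *ᵥ e))) *
      Real.exp (-(1 / 2) * ((x - (z + g)) ⬝ᵥ (Q⁻¹ + Hᵀ * R⁻¹ * H) *ᵥ (x - (z + g)))) := by
    intro x
    have hsq := complete_square hQ hR H (x - z) e
    rw [← hg, show e - H *ᵥ (x - z) = y - H *ᵥ x by rw [he, mulVec_sub]; abel,
      show x - z - g = x - (z + g) by abel] at hsq
    rw [gaussDensity_eq z hQ, mul_assoc _ (Real.exp _) (Real.exp _), ← Real.exp_add, ← mul_add,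
      ← hsq, mul_add, Real.exp_add]
    ring
  simp_rw [hint]
  rw [integral_const_mul, hP.integral_exp_neg_half, det_mul_det_inv_add hQ hR H, Fintype.card_fin,
    div_mul_cancel_left₀ hR.det_pos.ne', Real.sqrt_inv, Real.sqrt_mul hQ.det_pos.le, neg_div,
    Real.rpow_neg (by positivity)]
  have : (2 * Real.pi) ^ ((d : ℝ) / 2) ≠ 0 := by positivity
  field_simp

/-- A proposal with an arbitrary gain `K` dominates the target up to a determinant factor. -/
theorem likelihood_mul_gaussDensity_le {d m : ℕ} {Q : Matrix (Fin d) (Fin d) ℝ}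
    {R : Matrix (Fin m) (Fin m) ℝ} (hQ : Q.PosDef) (hR : R.PosDef)
    (H : Matrix (Fin m) (Fin d) ℝ) (K : Matrix (Fin d) (Fin m) ℝ) {C : Matrix (Fin d) (Fin d) ℝ}
    (hC : C = (1 - K * H) * Q * (1 - K * H)ᵀ + K * R * Kᵀ)
    (y : Fin m → ℝ) (z x : Fin d → ℝ) :
    Real.exp (-(1 / 2) * ((y - H *ᵥ x) ⬝ᵥ R⁻¹ *ᵥ (y - H *ᵥ x))) * gaussDensity z Q x ≤
      √(C.det / Q.det) * gaussDensity (z + K *ᵥ (y - H *ᵥ z)) C x := by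
  have hCp : C.PosDef := hC ▸ posDef_gain_covariance hQ hR H K
  have hle := dotProduct_inv_mulVec_sub_le hQ hR (A := 1 - K * H) (K := K)
    (hC ▸ isUnit_iff_ne_zero.2 hCp.det_pos.ne') (x - z) (y - H *ᵥ x)
  rw [← hC, show (1 - K * H) *ᵥ (x - z) - K *ᵥ (y - H *ᵥ x) = x - (z + K *ᵥ (y - H *ᵥ z)) by
    simp only [sub_mulVec, one_mulVec, mulVec_sub, ← mulVec_mulVec]; abel] at hle
  have hsC : √C.det ≠ 0 := (Real.sqrt_pos.2 hCp.det_pos).ne'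
  rw [gaussDensity_eq z hQ, gaussDensity_eq _ hCp, Real.sqrt_div hCp.det_pos.le]
  calc _ = (2 * Real.pi) ^ (-(d : ℝ) / 2) * (√Q.det)⁻¹ *
        Real.exp (-(1 / 2) * ((y - H *ᵥ x) ⬝ᵥ R⁻¹ *ᵥ (y - H *ᵥ x) +
          (x - z) ⬝ᵥ Q⁻¹ *ᵥ (x - z))) := by
        rw [mul_add, Real.exp_add]; ring
    _ ≤ (2 * Real.pi) ^ (-(d : ℝ) / 2) * (√Q.det)⁻¹ *
        Real.exp (-(1 / 2) * ((x - (z + K *ᵥ (y - H *ᵥ z))) ⬝ᵥ C⁻¹ *ᵥ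
          (x - (z + K *ᵥ (y - H *ᵥ z))))) := by
        gcongr _ * Real.exp ?_
        linarith
    _ = _ := by field_simp

/-- Raising the prior covariance from `Q` to `Q + P` in the gain costs at most the factor
`det (Q + P) / det Q` over the optimal covariance determinant. -/
theorem det_gain_covariance_le {d m : ℕ} {Q P : Matrix (Fin d) (Fin d) ℝ}
    {R : Matrix (Fin m) (Fin m) ℝ} (hQ : Q.PosDef) (hR : R.PosDef) (hP : P.PosSemidef)
    (H : Matrix (Fin m) (Fin d) ℝ) {K : Matrix (Fin d) (Fin m) ℝ}
    (hK : K = (Q + P) * Hᵀ * (H * (Q + P) * Hᵀ + R)⁻¹) :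
    ((1 - K * H) * Q * (1 - K * H)ᵀ + K * R * Kᵀ).det ≤
      (Q + P).det * R.det / (H * Q * Hᵀ + R).det := by
  have hQP := hQ.add_posSemidef hP
  have hS := posDef_mul_mul_transpose_add hQ.posSemidef hR H
  have hAP : ((1 - K * H) * P * (1 - K * H)ᵀ).PosSemidef := by
    simpa only [conjTranspose_eq_transpose_of_trivial] using
      hP.mul_mul_conjTranspose_same (1 - K * H)
  have hHP : (H * P * Hᵀ).PosSemidef := by simpa using hP.mul_mul_conjTranspose_same H
  have hSle := hS.det_le_det_add hHP
  rw [show H * Q * Hᵀ + R + H * P * Hᵀ = H * (Q + P) * Hᵀ + R by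
    rw [Matrix.mul_add, Matrix.add_mul]; abel] at hSle
  calc _ ≤ ((1 - K * H) * Q * (1 - K * H)ᵀ + K * R * Kᵀ + (1 - K * H) * P * (1 - K * H)ᵀ).det :=
        (posDef_gain_covariance hQ hR H K).det_le_det_add hAP
    _ = (Q + P).det * R.det / (H * (Q + P) * Hᵀ + R).det := by
        rw [← det_kalman_covariance hQP hR H rfl hK, Matrix.mul_add, Matrix.add_mul]
        congr 1
        abel
    _ ≤ _ := div_le_div_of_nonneg_left (mul_pos hQP.det_pos hR.det_pos).le hS.det_pos hSle

/-- Bound on the self-normalized importance weights: with the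
EnKF quantities of the context (previous-ensemble gain built from the empirical
covariance `Q_t` of the points `z_1,…,z_N` plus `Q`), for every `i` and `x`,
`p⁽ⁱ⁾(x)/(Z_mix·q⁽ⁱ⁾(x)) ≤ (det Q_t/det Q)^{1/2} ·
  ((1/N)·Σ_j exp(−½ (y − H z_j)ᵀ S⁻¹ (y − H z_j)))⁻¹`. -/
theorem importance_weight_bound
    {d m N : ℕ} (hd : 1 ≤ d) (hm : 1 ≤ m) (hN : 1 ≤ N)
    (H : Matrix (Fin m) (Fin d) ℝ)
    (Q : Matrix (Fin d) (Fin d) ℝ) (R : Matrix (Fin m) (Fin m) ℝ)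
    (hQ : Q.PosDef) (hR : R.PosDef)
    (y : Fin m → ℝ) (z : Fin N → Fin d → ℝ)
    (zbar : Fin d → ℝ) (hzbar : zbar = (N : ℝ)⁻¹ • ∑ i, z i)
    (Qt : Matrix (Fin d) (Fin d) ℝ)
    (hQt : Qt = ((N : ℝ) - 1)⁻¹ • (∑ i, vecMulVec (z i - zbar) (z i - zbar)) + Q)
    (S St : Matrix (Fin m) (Fin m) ℝ)
    (hS : S = H * Q * Hᵀ + R) (hSt : St = H * Qt * Hᵀ + R)
    (Kt : Matrix (Fin d) (Fin m) ℝ) (hKt : Kt = Qt * Hᵀ * St⁻¹)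
    (Sigt : Matrix (Fin d) (Fin d) ℝ)
    (hSigt : Sigt = (1 - Kt * H) * Q * (1 - Kt * H)ᵀ + Kt * R * Ktᵀ)
    -- the unnormalized targets, the proposals, and the mixture normalization
    (pf qf : Fin N → (Fin d → ℝ) → ℝ)
    (hpf : ∀ i x, pf i x =
      Real.exp (-(1 / 2) * ((y - H.mulVec x) ⬝ᵥ R⁻¹.mulVec (y - H.mulVec x)))
        * gaussDensity (z i) Q x)
    (hqf : ∀ i x, qf i x = gaussDensity (z i + Kt.mulVec (y - H.mulVec (z i))) Sigt x)
    (Zmix : ℝ) (hZmix : Zmix = (N : ℝ)⁻¹ * ∑ i, ∫ x, pf i x) :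
    ∀ (i : Fin N) (x : Fin d → ℝ),
      pf i x / (Zmix * qf i x) ≤
        (Qt.det / Q.det) ^ ((1 : ℝ) / 2) *
          ((N : ℝ)⁻¹ * ∑ j, Real.exp (-(1 / 2) *
            ((y - H.mulVec (z j)) ⬝ᵥ S⁻¹.mulVec (y - H.mulVec (z j)))))⁻¹ := by
  intro i x
  subst hSt hS
  set P := ((N : ℝ) - 1)⁻¹ • (∑ i, vecMulVec (z i - zbar) (z i - zbar)) with hPdef
  have hP : P.PosSemidef := by
    refine PosSemidef.smul (posSemidef_sum _ fun j _ => ?_) ?_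
    · simpa using posSemidef_vecMulVec_self_star (z j - zbar)
    · exact inv_nonneg.2 (sub_nonneg.2 (by exact_mod_cast hN))
  rw [add_comm] at hQt
  subst hQt
  have hS := posDef_mul_mul_transpose_add hQ.posSemidef hR H
  have hSig : Sigt.PosDef := hSigt ▸ posDef_gain_covariance hQ hR H Kt
  have hq : 0 < qf i x := by
    rw [hqf, gaussDensity_eq _ hSig]
    have := hSig.det_pos
    positivity
  have hN' : (0 : ℝ) < N := by exact_mod_cast hN
  have : Nonempty (Fin N) := ⟨i⟩
  set M := (N : ℝ)⁻¹ * ∑ j, Real.exp (-(1 / 2) *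
    ((y - H.mulVec (z j)) ⬝ᵥ (H * Q * Hᵀ + R)⁻¹.mulVec (y - H.mulVec (z j)))) with hM
  have hMpos : 0 < M :=
    mul_pos (inv_pos.2 hN') (Finset.sum_pos (fun j _ => Real.exp_pos _) Finset.univ_nonempty)
  have hZ : Zmix = √(R.det / (H * Q * Hᵀ + R).det) * M := by
    simp_rw [hZmix, hpf, integral_likelihood_mul_gaussDensity hQ hR]
    rw [← Finset.mul_sum, mul_left_comm]
  have hrs : 0 < R.det / (H * Q * Hᵀ + R).det := div_pos hR.det_pos hS.det_pos
  have hZpos : 0 < Zmix := hZ ▸ mul_pos (Real.sqrt_pos.2 hrs) hMpos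
  rw [div_le_iff₀ (mul_pos hZpos hq), hZ, ← Real.sqrt_eq_rpow]
  calc pf i x ≤ √(Sigt.det / Q.det) * qf i x := by
        rw [hpf, hqf]
        exact likelihood_mul_gaussDensity_le hQ hR H Kt hSigt y (z i) x
    _ ≤ √((Q + P).det / Q.det * (R.det / (H * Q * Hᵀ + R).det)) * qf i x := by
        gcongr
        rw [div_mul_eq_mul_div, ← mul_div_assoc]
        exact div_le_div_of_nonneg_right (hSigt ▸ det_gain_covariance_le hQ hR hP H hKt)
          hQ.det_pos.le
    _ = _ := by
        rw [Real.sqrt_mul' _ hrs.le]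
        field_simp
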